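/- arXiv:1805.12383 — 3 statements merged into one kernel-verified Lean document; each statement's English description precedes it below -/
import Mathlib

section
/- Consider a directed multi-commodity network with incidence matrix Γ and continuous, piecewise linear, nondecreasing cost functions l_e : ℝ_{≥0} → ℝ_{≥0} with l_e(ξ) > 0 for ξ > 0. Let X be a Wardrop equilibrium for demand matrix Y with total flow z and potentials π_j (j = 1,…,k) satisfying the potential characterization. For each edge e define the one-sided slopes a_e⁺ := lim_{ξ↓z_e} (l_e(ξ) − l_e(z_e))/(ξ − z_e) and a_e⁻ := lim_{ξ↑z_e} (l_e(ξ) − l_e(z_e))/(ξ − z_e) (with a_e⁻ := a_e⁺ if z_e = 0), and let A⁺ = diag(a⁺), A⁻ = diag(a⁻). Let ΔY be a demand direction matrix and let (X̂, ẑ) be an optimal solution of the convex program: minimize ½ ẑᵀ A⁺ ẑ⁺ + ½ ẑᵀ A⁻ ẑ⁻ subject to ẑ = X̂·𝟙, Γ X̂_j = ΔY_j for all j, x̂_{e,j} ≥ 0 for every edge e that is active but unused for commodity j, and x̂_{e,j} = 0 for every edge e that is inactive for commodity j, where ẑ⁺ and ẑ⁻ denote the componentwise positive and negative parts of ẑ.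 Then there exists ε > 0 such that X(ξ) := X + ξ X̂ is a Wardrop equilibrium for the demand matrix Y + ξ ΔY for every 0 ≤ ξ ≤ ε. -/
open Matrix BigOperators

/-- A directed walk from `a` to `b` given by the list of its edges. -/
inductive DirWalk {n m : ℕ} (src tgt : Fin m → Fin n) : Fin n → Fin n → List (Fin m) → Prop
  | nil (v : Fin n) : DirWalk src tgt v v []
  | cons (e : Fin m) {w : Fin n} {p : List (Fin m)} :
      DirWalk src tgt (tgt e) w p → DirWalk src tgt (src e) w (e :: p)

/-- A simple (vertex-repetition-free) directed path from `a` to `b`. -/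
def IsSimplePath {n m : ℕ} (src tgt : Fin m → Fin n) (a b : Fin n) (p : List (Fin m)) : Prop :=
  DirWalk src tgt a b p ∧ (a :: p.map tgt).Nodup

/-- The cost of a path, given the cost of each edge. -/
def pathCost {m : ℕ} (l : Fin m → ℝ) (p : List (Fin m)) : ℝ :=
  (p.map l).sum

/-- A multi-commodity flow `X` is a Wardrop equilibrium: for every commodity `j` no directed
cycle is flow-carrying, and every flow-carrying simple `s_j`-`t_j` path is at most as long as
any other simple `s_j`-`t_j` path (lengths w.r.t. the total flow). -/
def IsWardrop {n m k : ℕ} (src tgt : Fin m → Fin n) (s t : Fin k → Fin n)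
    (l : Fin m → ℝ → ℝ) (X : Fin m → Fin k → ℝ) : Prop :=
  (∀ j : Fin k, ¬ ∃ (v : Fin n) (p : List (Fin m)),
      p ≠ [] ∧ DirWalk src tgt v v p ∧ ∀ e ∈ p, 0 < X e j) ∧
  (∀ (j : Fin k) (P Q : List (Fin m)),
    IsSimplePath src tgt (s j) (t j) P → IsSimplePath src tgt (s j) (t j) Q →
    (∀ e ∈ P, 0 < X e j) →
    pathCost (fun e => l e (∑ j', X e j')) P ≤ pathCost (fun e => l e (∑ j', X e j')) Q)

/-- **Farkas' lemma** for finitely many linear functionals on a real vector space. -/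
theorem exists_nonneg_combination_of_forall_nonpos {ι V : Type*} [AddCommGroup V] [Module ℝ V]
    (s : Finset ι) (a : ι → V →ₗ[ℝ] ℝ) (b : V →ₗ[ℝ] ℝ)
    (h : ∀ x, (∀ i ∈ s, a i x ≤ 0) → b x ≤ 0) :
    ∃ c : ι → ℝ, (∀ i, 0 ≤ c i) ∧ ∀ x, b x = ∑ i ∈ s, c i * a i x := by
  classical
  induction s using Finset.induction_on generalizing a b with
  | empty =>
    refine ⟨0, fun _ => le_rfl, fun x => ?_⟩
    have h₁ := h x (by simp)
    have h₂ := h (-x) (by simp)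
    rw [map_neg] at h₂
    simp only [Finset.sum_empty]
    linarith
  | insert i₀ s hi₀ ih =>
    by_cases hb : ∀ x, (∀ i ∈ s, a i x ≤ 0) → b x ≤ 0
    · obtain ⟨c, hc, hbc⟩ := ih a b hb
      refine ⟨Function.update c i₀ 0, fun i => ?_, fun x => ?_⟩
      · by_cases hi : i = i₀
        · subst hi; simp
        · simpa [hi] using hc i
      · rw [Finset.sum_insert hi₀, hbc x, Function.update_self, zero_mul, zero_add]
        refine Finset.sum_congr rfl fun i hi => ?_
        rw [Function.update_of_ne (ne_of_mem_of_not_mem hi hi₀)]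
    · push Not at hb
      obtain ⟨x, hax, hbx⟩ := hb
      have hx₀ : 0 < a i₀ x := by
        by_contra! hle
        exact absurd (h x fun i hi => (Finset.mem_insert.1 hi).elim (fun e => e ▸ hle) (hax i))
          hbx.not_ge
      obtain ⟨c, hc, hbc⟩ := ih (fun i => a i - (a i x / a i₀ x) • a i₀)
        (b - (b x / a i₀ x) • a i₀) (fun y hy => by
          have key := h (y - (a i₀ y / a i₀ x) • x) (fun i hi => by
            rcases Finset.mem_insert.1 hi with rfl | hi
            · simp [hx₀.ne']
            · have := hy i hi
              simp only [LinearMap.sub_apply, LinearMap.smul_apply, smul_eq_mul, map_sub,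
                map_smul] at this ⊢
              calc _ = _ := by ring
                _ ≤ 0 := this)
          simp only [LinearMap.sub_apply, LinearMap.smul_apply, smul_eq_mul, map_sub,
            map_smul] at key ⊢
          calc _ = _ := by ring
            _ ≤ 0 := key)
      have hS : ∑ i ∈ s, c i * a i x ≤ 0 :=
        Finset.sum_nonpos fun i hi => mul_nonpos_of_nonneg_of_nonpos (hc i) (hax i hi)
      refine ⟨Function.update c i₀ ((b x - ∑ i ∈ s, c i * a i x) / a i₀ x),
        fun i => ?_, fun y => ?_⟩
      · by_cases hi : i = i₀
        · subst hi
          rw [Function.update_self]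
          exact div_nonneg (by linarith) hx₀.le
        · simpa [hi] using hc i
      · have hy := hbc y
        simp only [LinearMap.sub_apply, LinearMap.smul_apply, smul_eq_mul] at hy
        have hsum : ∑ i ∈ s, c i * (a i y - a i x / a i₀ x * a i₀ y) =
            ∑ i ∈ s, c i * a i y - (∑ i ∈ s, c i * a i x) / a i₀ x * a i₀ y := by
          rw [Finset.sum_div, Finset.sum_mul, ← Finset.sum_sub_distrib]
          exact Finset.sum_congr rfl fun i _ => by ring
        have hupd : ∑ i ∈ s, Function.update c i₀
            ((b x - ∑ i ∈ s, c i * a i x) / a i₀ x) i * a i y = ∑ i ∈ s, c i * a i y :=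
          Finset.sum_congr rfl fun i hi => by
            rw [Function.update_of_ne (ne_of_mem_of_not_mem hi hi₀)]
        rw [Finset.sum_insert hi₀, Function.update_self, hupd]
        rw [hsum] at hy
        linear_combination hy

/-- If the linear form `g` is nonnegative on all `D` with `Γ D = 0` that are nonnegative off `F`
and vanish off `A`, then some row combination of `Γ` is dominated by `g` on `A`, with equality
on `F ∩ A`. -/
theorem exists_vecMul_le_of_forall_circulation {n m : ℕ} (Γ : Matrix (Fin n) (Fin m) ℝ)
    (g : Fin m → ℝ) (F A : Set (Fin m))
    (h : ∀ D : Fin m → ℝ, Γ *ᵥ D = 0 → (∀ e ∉ F, 0 ≤ D e) → (∀ e ∉ A, D e = 0) →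
      0 ≤ ∑ e, g e * D e) :
    ∃ φ : Fin n → ℝ, ∀ e ∈ A, (φ ᵥ* Γ) e ≤ g e ∧ (e ∈ F → (φ ᵥ* Γ) e = g e) := by
  classical
  let row (v : Fin n) : (Fin m → ℝ) →ₗ[ℝ] ℝ := LinearMap.proj v ∘ₗ Γ.mulVecLin
  let nonneg (e : Fin m) : (Fin m → ℝ) →ₗ[ℝ] ℝ :=
    (if e ∈ F then (0 : ℝ) else -1) • LinearMap.proj e
  let nonpos (e : Fin m) : (Fin m → ℝ) →ₗ[ℝ] ℝ :=
    (if e ∈ A then (0 : ℝ) else 1) • LinearMap.proj e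
  let cost : (Fin m → ℝ) →ₗ[ℝ] ℝ := ∑ e, (-g e) • LinearMap.proj e
  have hcost (D) : cost D = -∑ e, g e * D e := by
    simp [cost, LinearMap.sum_apply, Finset.sum_neg_distrib]
  obtain ⟨c, hc, hcomb⟩ := exists_nonneg_combination_of_forall_nonpos Finset.univ
    (Sum.elim (Sum.elim row (-row)) (Sum.elim (Sum.elim nonneg nonpos)
      (fun e => (if e ∈ A then (0 : ℝ) else -1) • LinearMap.proj e))) cost (fun D hD => by
        rw [hcost, neg_nonpos]
        refine h D ?_ ?_ ?_
        · ext v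
          have h₁ := hD (.inl (.inl v)) (Finset.mem_univ _)
          have h₂ := hD (.inl (.inr v)) (Finset.mem_univ _)
          simp only [Sum.elim_inl, Sum.elim_inr, row, Pi.neg_apply, LinearMap.neg_apply,
            LinearMap.comp_apply, LinearMap.proj_apply, mulVecLin_apply] at h₁ h₂
          simp only [Pi.zero_apply]
          linarith
        · intro e he
          simpa [nonneg, he] using hD (.inr (.inl (.inl e))) (Finset.mem_univ _)
        · intro e he
          refine le_antisymm ?_ ?_
          · simpa [nonpos, he] using hD (.inr (.inl (.inr e))) (Finset.mem_univ _)
          · simpa [he] using hD (.inr (.inr e)) (Finset.mem_univ _))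
  refine ⟨fun v => c (.inl (.inr v)) - c (.inl (.inl v)), fun e he => ?_⟩
  have hcoord := hcomb (Pi.single e 1)
  rw [hcost] at hcoord
  have hrow : ((fun v => c (.inl (.inr v)) - c (.inl (.inl v))) ᵥ* Γ) e =
      ∑ v, c (.inl (.inr v)) * Γ v e - ∑ v, c (.inl (.inl v)) * Γ v e := by
    simp [vecMul, dotProduct, sub_mul]
  have hce := hc (.inr (.inl (.inl e)))
  rw [hrow]
  by_cases heF : e ∈ F <;>
    simp [Fintype.sum_sum_type, row, nonneg, nonpos, Pi.single_apply, he, heF, -ite_smul]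
      at hcoord
  · exact ⟨by linarith, fun _ => by linarith⟩
  · exact ⟨by linarith, fun hF => absurd hF heF⟩

theorem mul_max_zero_add_le (u h : ℝ) :
    (u + h) * max (u + h) 0 ≤ u * max u 0 + 2 * max u 0 * h + h ^ 2 := by
  rcases le_total u 0 with hu | hu <;> rcases le_total (u + h) 0 with huh | huh <;>
    simp only [max_eq_left, max_eq_right, hu, huh] <;> nlinarith [sq_nonneg (u + h), sq_nonneg h]

theorem mul_min_zero_add_le (u h : ℝ) :
    (u + h) * min (u + h) 0 ≤ u * min u 0 + 2 * min u 0 * h + h ^ 2 := by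
  rcases le_total u 0 with hu | hu <;> rcases le_total (u + h) 0 with huh | huh <;>
    simp only [min_eq_left, min_eq_right, hu, huh] <;> nlinarith [sq_nonneg (u + h), sq_nonneg h]

theorem DirWalk.potential_sub_le {n m : ℕ} {src tgt : Fin m → Fin n} {a b : Fin n}
    {p : List (Fin m)} (hp : DirWalk src tgt a b p) (π : Fin n → ℝ) (c : Fin m → ℝ)
    (h : ∀ e ∈ p, π (tgt e) - π (src e) ≤ c e) : π b - π a ≤ pathCost c p := by
  induction hp with
  | nil v => simp [pathCost]
  | cons e _ ih =>
    have h₁ := h e (by simp)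
    have h₂ := ih fun e' he' => h e' (by simp [he'])
    simp only [pathCost, List.map_cons, List.sum_cons] at h₂ ⊢
    linarith

theorem DirWalk.potential_sub_eq {n m : ℕ} {src tgt : Fin m → Fin n} {a b : Fin n}
    {p : List (Fin m)} (hp : DirWalk src tgt a b p) (π : Fin n → ℝ) (c : Fin m → ℝ)
    (h : ∀ e ∈ p, π (tgt e) - π (src e) = c e) : π b - π a = pathCost c p := by
  induction hp with
  | nil v => simp [pathCost]
  | cons e _ ih =>
    have h₁ := h e (by simp)
    have h₂ := ih fun e' he' => h e' (by simp [he'])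
    simp only [pathCost, List.map_cons, List.sum_cons] at h₂ ⊢
    linarith

/-- A nonnegative flow admitting compatible potentials is a Wardrop equilibrium. -/
theorem isWardrop_of_potential {n m k : ℕ} {src tgt : Fin m → Fin n} {s t : Fin k → Fin n}
    {l : Fin m → ℝ → ℝ} {X : Fin m → Fin k → ℝ} (hpos : ∀ e ξ, 0 < ξ → 0 < l e ξ)
    (hX : ∀ e j, 0 ≤ X e j) (π : Fin k → Fin n → ℝ)
    (hle : ∀ j e, π j (tgt e) - π j (src e) ≤ l e (∑ j', X e j'))
    (heq : ∀ j e, 0 < X e j → π j (tgt e) - π j (src e) = l e (∑ j', X e j')) :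
    IsWardrop src tgt s t l X := by
  refine ⟨?_, fun j P Q hP hQ hXP => ?_⟩
  · rintro j ⟨v, p, hp, hw, hXp⟩
    have hcost := hw.potential_sub_eq (π j) _ fun e he => heq j e (hXp e he)
    rw [sub_self] at hcost
    refine (List.sum_pos _ ?_ (by simpa using hp)).ne hcost
    intro x hx
    obtain ⟨e, he, rfl⟩ := List.mem_map.1 hx
    exact hpos e _ ((hXp e he).trans_le
      (Finset.single_le_sum (fun j' _ => hX e j') (Finset.mem_univ j)))
  · rw [← hP.1.potential_sub_eq (π j) _ fun e he => heq j e (hXP e he)]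
    exact hQ.1.potential_sub_le (π j) _ fun e _ => hle j e

open Filter Topology in
theorem nonneg_of_eventually_nonneg_quadratic {S C : ℝ}
    (h : ∀ᶠ τ in 𝓝[>] (0 : ℝ), 0 ≤ τ * S + τ ^ 2 * C) : 0 ≤ S := by
  by_contra! hS
  have hlim : Tendsto (fun τ : ℝ => S + τ * C) (𝓝[>] 0) (𝓝 S) := by
    have hc : Continuous fun τ : ℝ => S + τ * C := by fun_prop
    simpa using (hc.tendsto 0).mono_left nhdsWithin_le_nhds
  obtain ⟨τ, ⟨h₁, h₂⟩, h₃⟩ :=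
    ((h.and (hlim.eventually_lt_const hS)).and self_mem_nhdsWithin).exists
  have h₃ : 0 < τ := h₃
  nlinarith

open Filter Topology in
theorem eventually_lt_add_mul {a b : ℝ} (h : a < b) (c : ℝ) :
    ∀ᶠ ξ in 𝓝 (0 : ℝ), a < b + ξ * c := by
  have hc : Continuous fun ξ : ℝ => b + ξ * c := by fun_prop
  exact (hc.tendsto 0).eventually_const_lt (by simpa using h)

open Filter Topology in
/-- Augmenting equilibria for multi-commodity networks: if `X` is a Wardrop
equilibrium for demand matrix `Y` with potentials `π_j`, the (piecewise linear) costs have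
one-sided slopes `a⁺`, `a⁻` at the total flow `z`, and `(X̂, ẑ)` is an optimal solution of the
associated convex quadratic program for a demand direction `ΔY`, then there is `ε > 0` such
that `X + ξ X̂` is a Wardrop equilibrium for the demand `Y + ξ ΔY` for all `0 ≤ ξ ≤ ε`. -/
theorem augmenting_equilibrium_multicommodity
    (n m k : ℕ) (src tgt : Fin m → Fin n)
    (hsl : ∀ e, src e ≠ tgt e)
    (hpar : ∀ e e', src e = src e' → tgt e = tgt e' → e = e')
    (Γ : Matrix (Fin n) (Fin m) ℝ)
    (hΓ : ∀ v e, Γ v e = if v = tgt e then 1 else if v = src e then -1 else 0)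
    (l : Fin m → ℝ → ℝ)
    (hcont : ∀ e, ContinuousOn (l e) (Set.Ici 0))
    (hmono : ∀ e, MonotoneOn (l e) (Set.Ici 0))
    (hnn : ∀ e ξ, 0 ≤ ξ → 0 ≤ l e ξ)
    (hpos : ∀ e ξ, 0 < ξ → 0 < l e ξ)
    (s t : Fin k → Fin n) (q : Fin k → ℝ) (hq : ∀ j, 0 ≤ q j)
    (Y : Matrix (Fin n) (Fin k) ℝ)
    (hY : ∀ v j, Y v j = (if v = t j then q j else 0) - (if v = s j then q j else 0))
    (X : Matrix (Fin m) (Fin k) ℝ)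
    (hXnn : ∀ e j, 0 ≤ X e j)
    (hfeas : Γ * X = Y)
    (hW : IsWardrop src tgt s t l (fun e j => X e j))
    (π : Fin k → Fin n → ℝ)
    (hpot : ∀ (j : Fin k) (e : Fin m),
      π j (tgt e) - π j (src e) ≤ l e (∑ j', X e j') ∧
      (0 < X e j → π j (tgt e) - π j (src e) = l e (∑ j', X e j')))
    (aplus aminus : Fin m → ℝ)
    -- the cost of `e` is piecewise linear at `z_e` with right slope `a⁺_e` and left slope `a⁻_e`
    (hslope : ∀ e, ∃ δ > (0 : ℝ),
      (∀ ξ, (∑ j', X e j') ≤ ξ → ξ ≤ (∑ j', X e j') + δ →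
        l e ξ = l e (∑ j', X e j') + aplus e * (ξ - ∑ j', X e j')) ∧
      (∀ ξ, (∑ j', X e j') - δ ≤ ξ → ξ ≤ (∑ j', X e j') → 0 ≤ ξ →
        l e ξ = l e (∑ j', X e j') + aminus e * (ξ - ∑ j', X e j')))
    (hz0 : ∀ e, (∑ j', X e j') = 0 → aminus e = aplus e)
    (Δq : Fin k → ℝ) (ΔY : Matrix (Fin n) (Fin k) ℝ)
    (hΔY : ∀ v j, ΔY v j = (if v = t j then Δq j else 0) - (if v = s j then Δq j else 0))
    (Xhat : Matrix (Fin m) (Fin k) ℝ) (zhat : Fin m → ℝ)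
    -- `(X̂, ẑ)` is feasible for the convex program
    (hfeasProg : (∀ e, zhat e = ∑ j, Xhat e j) ∧ Γ * Xhat = ΔY ∧
      (∀ (e : Fin m) (j : Fin k),
        (π j (tgt e) - π j (src e) = l e (∑ j', X e j') ∧ X e j = 0) → 0 ≤ Xhat e j) ∧
      (∀ (e : Fin m) (j : Fin k),
        π j (tgt e) - π j (src e) < l e (∑ j', X e j') → Xhat e j = 0))
    -- `(X̂, ẑ)` minimizes `½ ẑᵀ A⁺ ẑ⁺ + ½ ẑᵀ A⁻ ẑ⁻` among all feasible points
    (hopt : ∀ (W : Matrix (Fin m) (Fin k) ℝ) (u : Fin m → ℝ),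
      ((∀ e, u e = ∑ j, W e j) ∧ Γ * W = ΔY ∧
       (∀ (e : Fin m) (j : Fin k),
         (π j (tgt e) - π j (src e) = l e (∑ j', X e j') ∧ X e j = 0) → 0 ≤ W e j) ∧
       (∀ (e : Fin m) (j : Fin k),
         π j (tgt e) - π j (src e) < l e (∑ j', X e j') → W e j = 0)) →
      (∑ e, aplus e * zhat e * max (zhat e) 0) / 2 +
        (∑ e, aminus e * zhat e * min (zhat e) 0) / 2 ≤
      (∑ e, aplus e * u e * max (u e) 0) / 2 +
        (∑ e, aminus e * u e * min (u e) 0) / 2) :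
    ∃ ε > (0 : ℝ), ∀ ξ : ℝ, 0 ≤ ξ → ξ ≤ ε →
      (∀ e j, 0 ≤ X e j + ξ * Xhat e j) ∧
      Γ * (X + ξ • Xhat) = Y + ξ • ΔY ∧
      IsWardrop src tgt s t l (fun e j => X e j + ξ * Xhat e j) := by
  classical
  obtain ⟨hzhat, hΓX, hact, hinact⟩ := hfeasProg
  set z : Fin m → ℝ := fun e => ∑ j', X e j'
  have hz_nonneg (e) : 0 ≤ z e := Finset.sum_nonneg fun j _ => hXnn e j
  have haplus (e) : 0 ≤ aplus e := by
    obtain ⟨δ, hδ, hr, -⟩ := hslope e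
    have h₁ := hr (z e + δ) (by linarith) le_rfl
    have h₂ := hmono e (hz_nonneg e) (show 0 ≤ z e + δ by linarith [hz_nonneg e])
      (by linarith : z e ≤ z e + δ)
    change l e (z e + δ) = l e (z e) + aplus e * (z e + δ - z e) at h₁
    exact nonneg_of_mul_nonneg_left (by linarith : 0 ≤ aplus e * (z e + δ - z e)) (by linarith)
  have haminus (e) : 0 ≤ aminus e := by
    rcases (hz_nonneg e).eq_or_lt with h0 | h0
    · rw [hz0 e h0.symm]; exact haplus e
    · obtain ⟨δ, hδ, -, hl⟩ := hslope e
      have hy : 0 ≤ max 0 (z e - δ) := le_max_left _ _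
      have hlt : max 0 (z e - δ) < z e := max_lt h0 (by linarith)
      have h₁ := hl (max 0 (z e - δ)) (le_max_right _ _) hlt.le hy
      have h₂ := hmono e hy (hz_nonneg e) hlt.le
      change l e (max 0 (z e - δ)) = l e (z e) + aminus e * (max 0 (z e - δ) - z e) at h₁
      exact nonneg_of_mul_nonneg_left
        (by linarith : 0 ≤ aminus e * (z e - max 0 (z e - δ))) (by linarith)
  -- The gradient of the objective at `ẑ`.
  let g (e : Fin m) : ℝ := aplus e * max (zhat e) 0 + aminus e * min (zhat e) 0
  have hactive (j e) : π j (tgt e) - π j (src e) = l e (z e) ∨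
      (π j (tgt e) - π j (src e) < l e (z e) ∧ X e j = 0 ∧ Xhat e j = 0) := by
    rcases (hpot j e).1.lt_or_eq with h | h
    · refine .inr ⟨h, ?_, hinact e j h⟩
      by_contra hne
      exact h.ne ((hpot j e).2 (lt_of_le_of_ne (hXnn e j) (Ne.symm hne)))
    · exact .inl h
  have hstationary (j : Fin k) (D : Fin m → ℝ) (hΓD : Γ *ᵥ D = 0)
      (hDF : ∀ e ∉ {e | 0 < X e j ∨ 0 < Xhat e j}, 0 ≤ D e)
      (hDA : ∀ e ∉ {e | π j (tgt e) - π j (src e) = l e (z e)}, D e = 0) :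
      0 ≤ ∑ e, g e * D e := by
    refine nonneg_of_eventually_nonneg_quadratic
      (C := ∑ e, (aplus e + aminus e) / 2 * D e ^ 2) ?_
    have hsmall : ∀ᶠ τ in 𝓝[>] (0 : ℝ), ∀ e, 0 < Xhat e j → 0 < Xhat e j + τ * D e :=
      Filter.eventually_all.2 fun e => by
        by_cases h : 0 < Xhat e j
        · filter_upwards [nhdsWithin_le_nhds (eventually_lt_add_mul h (D e))] with τ hτ _
          exact hτ
        · exact .of_forall fun τ h' => absurd h' h
    filter_upwards [hsmall, self_mem_nhdsWithin] with τ hτ hτ0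
    have hτ0 : 0 < τ := hτ0
    have hcmp := hopt (Xhat + τ • Matrix.vecMulVec D (Pi.single j 1)) (fun e => zhat e + τ * D e)
      ⟨fun e => by
        simp [Matrix.vecMulVec_apply, Finset.sum_add_distrib, hzhat, ← Finset.mul_sum],
      by
        rw [Matrix.mul_add, Matrix.mul_smul, Matrix.mul_vecMulVec, hΓD, hΓX]
        simp,
      fun e j' ⟨hπ, hX0⟩ => by
        have h0 := hact e j' ⟨hπ, hX0⟩
        rcases eq_or_ne j' j with rfl | hj
        · simp only [Matrix.add_apply, Matrix.smul_apply, Matrix.vecMulVec_apply,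
            Pi.single_eq_same, mul_one, smul_eq_mul]
          rcases h0.eq_or_lt with h | h
          · have := hDF e (by simp [hX0, ← h])
            rw [← h]; positivity
          · exact (hτ e h).le
        · simpa [Matrix.vecMulVec_apply, hj] using h0,
      fun e j' hlt => by
        have h0 := hinact e j' hlt
        rcases eq_or_ne j' j with rfl | hj
        · simp [Matrix.vecMulVec_apply, h0, hDA e hlt.ne]
        · simpa [Matrix.vecMulVec_apply, hj] using h0⟩
    have hbound : ∀ e, aplus e * (zhat e + τ * D e) * max (zhat e + τ * D e) 0 +
        aminus e * (zhat e + τ * D e) * min (zhat e + τ * D e) 0 ≤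
        aplus e * zhat e * max (zhat e) 0 + aminus e * zhat e * min (zhat e) 0 +
        2 * (τ * (g e * D e) + τ ^ 2 * ((aplus e + aminus e) / 2 * D e ^ 2)) := fun e => by
      have h₁ := mul_le_mul_of_nonneg_left (mul_max_zero_add_le (zhat e) (τ * D e)) (haplus e)
      have h₂ := mul_le_mul_of_nonneg_left (mul_min_zero_add_le (zhat e) (τ * D e)) (haminus e)
      simp only [g]
      linarith
    have hsum := Finset.sum_le_sum fun e (_ : e ∈ Finset.univ) => hbound e
    simp only [Finset.sum_add_distrib, ← Finset.mul_sum] at hsum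
    linarith
  choose φ hφ using fun j => exists_vecMul_le_of_forall_circulation Γ g _ _ (hstationary j)
  have hvecMul (j e) : (φ j ᵥ* Γ) e = φ j (tgt e) - φ j (src e) := by
    have hne : tgt e ≠ src e := (hsl e).symm
    have hsplit : ∀ v, φ j v * Γ v e =
        (if v = tgt e then φ j v else 0) - (if v = src e then φ j v else 0) := fun v => by
      rw [hΓ]
      by_cases h₁ : v = tgt e
      · simp [h₁, hne]
      · by_cases h₂ : v = src e <;> simp [h₁, h₂, hne.symm]
    simp only [vecMul, dotProduct, hsplit, Finset.sum_sub_distrib, Finset.sum_ite_eq',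
      Finset.mem_univ, if_true]
  have hflow : ∀ᶠ ξ in 𝓝[≥] (0 : ℝ), ∀ e j, 0 ≤ X e j + ξ * Xhat e j :=
    Filter.eventually_all.2 fun e => Filter.eventually_all.2 fun j => by
      rcases (hXnn e j).eq_or_lt with h | h
      · have h0 : 0 ≤ Xhat e j := by
          rcases hactive j e with hπ | hπ
          · exact hact e j ⟨hπ, h.symm⟩
          · exact hπ.2.2.ge
        filter_upwards [self_mem_nhdsWithin] with ξ hξ
        have hξ : 0 ≤ ξ := hξ
        rw [← h]; positivity
      · filter_upwards [nhdsWithin_le_nhds (eventually_lt_add_mul h (Xhat e j))] with ξ hξ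
        exact hξ.le
  have hcost : ∀ᶠ ξ in 𝓝[≥] (0 : ℝ), ∀ e, l e (z e + ξ * zhat e) = l e (z e) + ξ * g e :=
    Filter.eventually_all.2 fun e => by
      obtain ⟨δ, hδ, hr, hl⟩ := hslope e
      filter_upwards [hflow, self_mem_nhdsWithin,
        nhdsWithin_le_nhds (eventually_lt_add_mul hδ (zhat e)),
        nhdsWithin_le_nhds (eventually_lt_add_mul hδ (-zhat e))] with ξ hX hξ h₁ h₂
      have hξ : 0 ≤ ξ := hξ
      rcases le_total 0 (zhat e) with h | h
      · have hprod := mul_nonneg hξ h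
        have := hr (z e + ξ * zhat e) (by linarith) (by linarith)
        simp only [g, max_eq_left h, min_eq_right h]
        linear_combination this
      · have hprod := mul_nonpos_of_nonneg_of_nonpos hξ h
        have hnonneg : 0 ≤ z e + ξ * zhat e := by
          have := Finset.sum_nonneg fun j (_ : j ∈ Finset.univ) => hX e j
          rwa [Finset.sum_add_distrib, ← Finset.mul_sum, ← hzhat] at this
        have := hl (z e + ξ * zhat e) (by linarith) (by linarith) hnonneg
        simp only [g, max_eq_right h, min_eq_left h]
        linear_combination this
  have hslack : ∀ᶠ ξ in 𝓝[≥] (0 : ℝ), ∀ e j, π j (tgt e) - π j (src e) < l e (z e) →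
      π j (tgt e) - π j (src e) < l e (z e) + ξ * (g e - (φ j (tgt e) - φ j (src e))) :=
    Filter.eventually_all.2 fun e => Filter.eventually_all.2 fun j => by
      by_cases h : π j (tgt e) - π j (src e) < l e (z e)
      · filter_upwards [nhdsWithin_le_nhds (eventually_lt_add_mul h _)] with ξ hξ _
        exact hξ
      · exact .of_forall fun ξ h' => absurd h' h
  obtain ⟨ε, hε, hall⟩ := mem_nhdsGE_iff_exists_Icc_subset.1 (hflow.and (hcost.and hslack))
  refine ⟨ε, hε, fun ξ hξ0 hξε => ?_⟩
  obtain ⟨hX, hc, hs⟩ := hall ⟨hξ0, hξε⟩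
  refine ⟨hX, by rw [Matrix.mul_add, Matrix.mul_smul, hfeas, hΓX], ?_⟩
  have htotal (e) : l e (∑ j', (X e j' + ξ * Xhat e j')) = l e (z e) + ξ * g e := by
    rw [← hc e, Finset.sum_add_distrib, ← Finset.mul_sum, ← hzhat]
  refine isWardrop_of_potential hpos hX (fun j v => π j v + ξ * φ j v) (fun j e => ?_)
    (fun j e hpos' => ?_)
  · rw [htotal]
    rcases hactive j e with hπ | ⟨hπ, -⟩
    · have hle := mul_le_mul_of_nonneg_left (hφ j e hπ).1 hξ0
      rw [hvecMul] at hle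
      linarith
    · linarith [hs e j hπ]
  · rw [htotal]
    have hused : 0 < X e j ∨ 0 < Xhat e j := by
      by_contra! hnot
      linarith [mul_nonpos_of_nonneg_of_nonpos hξ0 hnot.2]
    have hπ : π j (tgt e) - π j (src e) = l e (z e) := by
      rcases hactive j e with hπ | ⟨-, h₁, h₂⟩
      · exact hπ
      · rcases hused with h | h <;> linarith
    have heq := (hφ j e hπ).2 hused
    rw [hvecMul] at heq
    linear_combination hπ + ξ * heq
end

section
/- Consider an undirected single-commodity network with incidence matrix Γ, source s, sink t, and cost functions l_e : ℝ → ℝ that are continuous, strictly increasing, piecewise linear with finitely many breakpoints, with l_e(ξ) > 0 for ξ > 0 and l_e(ξ) < 0 for ξ < 0. Let x^q̃ be a Wardrop equilibrium for demand rate q̃ ≥ 0. Define a_e⁺ := lim_{ξ↓x_e^q̃} (l_e(ξ) − l_e(x_e^q̃))/(ξ − x_e^q̃) and a_e⁻ := lim_{ξ↑x_e^q̃} (l_e(ξ) − l_e(x_e^q̃))/(ξ − x_e^q̃), and A⁺ := diag(a⁺), A⁻ := diag(a⁻). Let Δy ∈ ℝⁿ have entries −1 at s, +1 at t, and 0 elsewhere,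 and let (x̂, x̂⁺, x̂⁻) be an optimal solution of the convex program: minimize ½ (x⁺)ᵀ A⁺ x⁺ + ½ (x⁻)ᵀ A⁻ x⁻ subject to Γ x = Δy, x = x⁺ + x⁻, x⁺ ≥ 0, x⁻ ≤ 0. Then there exists ε > 0 such that x(q) := x^q̃ + (q − q̃) x̂ is a Wardrop equilibrium for demand rate q for every q̃ ≤ q ≤ q̃ + ε. -/
open Matrix BigOperators

/-- An undirected walk from `a` to `b`, given by the list of its steps; a step `(e, true)`
traverses edge `e` in its orientation, a step `(e, false)` traverses it backwards. -/
inductive UWalk {n m : ℕ} (src tgt : Fin m → Fin n) :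
    Fin n → Fin n → List (Fin m × Bool) → Prop
  | nil (v : Fin n) : UWalk src tgt v v []
  | consF (e : Fin m) {w : Fin n} {p : List (Fin m × Bool)} :
      UWalk src tgt (tgt e) w p → UWalk src tgt (src e) w ((e, true) :: p)
  | consB (e : Fin m) {w : Fin n} {p : List (Fin m × Bool)} :
      UWalk src tgt (src e) w p → UWalk src tgt (tgt e) w ((e, false) :: p)

/-- The vertex a step of an undirected walk leads to. -/
def stepHead {n m : ℕ} (src tgt : Fin m → Fin n) (st : Fin m × Bool) : Fin n :=
  if st.2 then tgt st.1 else src st.1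

/-- A simple (vertex-repetition-free) undirected path from `a` to `b`. -/
def IsSimpleUPath {n m : ℕ} (src tgt : Fin m → Fin n) (a b : Fin n)
    (p : List (Fin m × Bool)) : Prop :=
  UWalk src tgt a b p ∧ (a :: p.map (stepHead src tgt)).Nodup

/-- The cost `l_P = Σ_{e ∈ P} l_e χ_{P,e}` of an undirected path, given edge costs `l`. -/
def upathCost {m : ℕ} (l : Fin m → ℝ) (p : List (Fin m × Bool)) : ℝ :=
  (p.map (fun st => if st.2 then l st.1 else -(l st.1))).sum

/-- An undirected walk is flow-carrying for `x` if `x_e χ_{P,e} > 0` on each of its steps. -/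
def UFlowCarrying {m : ℕ} (x : Fin m → ℝ) (p : List (Fin m × Bool)) : Prop :=
  ∀ st ∈ p, if st.2 then 0 < x st.1 else x st.1 < 0

/-- An undirected flow `x` is a Wardrop equilibrium: no undirected cycle is flow-carrying
and every flow-carrying simple `s`-`t` path is at most as long as any other simple
`s`-`t` path. -/
def IsUWardrop {n m : ℕ} (src tgt : Fin m → Fin n) (s t : Fin n)
    (l : Fin m → ℝ → ℝ) (x : Fin m → ℝ) : Prop :=
  (¬ ∃ (v : Fin n) (p : List (Fin m × Bool)),
      p ≠ [] ∧ UWalk src tgt v v p ∧ UFlowCarrying x p) ∧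
  (∀ P Q, IsSimpleUPath src tgt s t P → IsSimpleUPath src tgt s t Q →
    UFlowCarrying x P →
    upathCost (fun e => l e (x e)) P ≤ upathCost (fun e => l e (x e)) Q)

section Walks

variable {n m : ℕ} {src tgt : Fin m → Fin n}

theorem uwalk_nil_iff {a b : Fin n} : UWalk src tgt a b [] ↔ a = b := by
  constructor
  · rintro ⟨⟩
    rfl
  · rintro rfl
    exact UWalk.nil a

/-- Exchanging `src` and `tgt` in `stepHead` gives the vertex a step starts from. -/
theorem uwalk_cons_iff {a b : Fin n} {st : Fin m × Bool} {p : List (Fin m × Bool)} :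
    UWalk src tgt a b (st :: p) ↔
      a = stepHead tgt src st ∧ UWalk src tgt (stepHead src tgt st) b p := by
  constructor
  · intro h
    cases h with
    | consF e h => exact ⟨by simp [stepHead], by simpa [stepHead] using h⟩
    | consB e h => exact ⟨by simp [stepHead], by simpa [stepHead] using h⟩
  · obtain ⟨e, d⟩ := st
    rintro ⟨rfl, h⟩
    cases d
    · exact UWalk.consB e h
    · exact UWalk.consF e h

theorem uwalk_append_iff {a b : Fin n} {p q : List (Fin m × Bool)} :
    UWalk src tgt a b (p ++ q) ↔ ∃ v, UWalk src tgt a v p ∧ UWalk src tgt v b q := by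
  induction p generalizing a with
  | nil => simp [uwalk_nil_iff]
  | cons st p ih => simp [uwalk_cons_iff, ih, and_assoc]

theorem UWalk.append {a v b : Fin n} {p q : List (Fin m × Bool)}
    (hp : UWalk src tgt a v p) (hq : UWalk src tgt v b q) : UWalk src tgt a b (p ++ q) :=
  uwalk_append_iff.2 ⟨v, hp, hq⟩

theorem UWalk.exists_reverse {a b : Fin n} {p : List (Fin m × Bool)}
    (hp : UWalk src tgt a b p) :
    ∃ p', UWalk src tgt b a p' ∧ ∀ st ∈ p', ∃ st' ∈ p, st'.1 = st.1 := by
  induction hp with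
  | nil v => exact ⟨[], UWalk.nil v, by simp⟩
  | consF e _ ih =>
    obtain ⟨p', hw, hp'⟩ := ih
    refine ⟨p' ++ [(e, false)], hw.append (UWalk.consB e (UWalk.nil _)), ?_⟩
    intro st hst
    rcases List.mem_append.1 hst with h | h
    · obtain ⟨st', h1, h2⟩ := hp' st h
      exact ⟨st', List.mem_cons_of_mem _ h1, h2⟩
    · exact ⟨(e, true), by simp, by simp_all⟩
  | consB e _ ih =>
    obtain ⟨p', hw, hp'⟩ := ih
    refine ⟨p' ++ [(e, true)], hw.append (UWalk.consF e (UWalk.nil _)), ?_⟩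
    intro st hst
    rcases List.mem_append.1 hst with h | h
    · obtain ⟨st', h1, h2⟩ := hp' st h
      exact ⟨st', List.mem_cons_of_mem _ h1, h2⟩
    · exact ⟨(e, false), by simp, by simp_all⟩

theorem UWalk.exists_split_of_mem {a b v : Fin n} {p : List (Fin m × Bool)}
    (hp : UWalk src tgt a b p) (hv : v ∈ p.map (stepHead src tgt)) :
    ∃ c q, p = c ++ q ∧ c ≠ [] ∧ UWalk src tgt a v c ∧ UWalk src tgt v b q := by
  obtain ⟨st, hst, rfl⟩ := List.mem_map.1 hv
  obtain ⟨c, q, rfl⟩ := List.append_of_mem hst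
  obtain ⟨w, hc, hq⟩ := uwalk_append_iff.1 hp
  obtain ⟨rfl, hrest⟩ := uwalk_cons_iff.1 hq
  exact ⟨c ++ [st], q, by simp, by simp,
    hc.append (uwalk_cons_iff.2 ⟨rfl, UWalk.nil _⟩), hrest⟩

/-- A walk that is not a simple path contains a nonempty closed walk. -/
theorem UWalk.exists_closed_of_not_nodup {a b : Fin n} {p : List (Fin m × Bool)}
    (hp : UWalk src tgt a b p) (hnd : ¬ (a :: p.map (stepHead src tgt)).Nodup) :
    ∃ p₁ c p₂ v, p = p₁ ++ (c ++ p₂) ∧ c ≠ [] ∧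
      UWalk src tgt a v p₁ ∧ UWalk src tgt v v c ∧ UWalk src tgt v b p₂ := by
  induction p generalizing a with
  | nil => simp at hnd
  | cons st p ih =>
    by_cases ha : a ∈ (st :: p).map (stepHead src tgt)
    · obtain ⟨c, q, h, hc, hac, hq⟩ := hp.exists_split_of_mem ha
      exact ⟨[], c, q, a, by simpa using h, hc, UWalk.nil a, hac, hq⟩
    · obtain ⟨h₁, h₂⟩ := uwalk_cons_iff.1 hp
      have hnd' : ¬ (stepHead src tgt st :: p.map (stepHead src tgt)).Nodup :=
        fun h => hnd (List.nodup_cons.2 ⟨ha, h⟩)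
      obtain ⟨p₁, c, p₂, v, rfl, hc, hw₁, hw₂, hw₃⟩ := ih h₂ hnd'
      exact ⟨st :: p₁, c, p₂, v, rfl, hc, uwalk_cons_iff.2 ⟨h₁, hw₁⟩, hw₂, hw₃⟩

theorem UWalk.exists_simple_sublist {a b : Fin n} {p : List (Fin m × Bool)}
    (hp : UWalk src tgt a b p) :
    ∃ p', IsSimpleUPath src tgt a b p' ∧ p'.Sublist p := by
  induction hk : p.length using Nat.strong_induction_on generalizing p with
  | _ k ih =>
    by_cases hnd : (a :: p.map (stepHead src tgt)).Nodup
    · exact ⟨p, ⟨hp, hnd⟩, List.Sublist.refl p⟩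
    · obtain ⟨p₁, c, p₂, v, rfl, hc, hw₁, -, hw₃⟩ := hp.exists_closed_of_not_nodup hnd
      have hlen : (p₁ ++ p₂).length < k := by
        have := List.length_pos_of_ne_nil hc
        simp only [List.length_append] at hk ⊢
        omega
      obtain ⟨p', hs, hsub⟩ := ih _ hlen (hw₁.append hw₃) rfl
      exact ⟨p', hs, hsub.trans
        (List.Sublist.append_left (List.sublist_append_right c p₂) p₁)⟩

end Walks

section Costs

variable {n m : ℕ} {src tgt : Fin m → Fin n}

/-- The signed value `y_e χ_{P,e}` of a step of an undirected walk. -/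
def stepVal (y : Fin m → ℝ) (st : Fin m × Bool) : ℝ :=
  if st.2 then y st.1 else -(y st.1)

theorem upathCost_eq (y : Fin m → ℝ) (p : List (Fin m × Bool)) :
    upathCost y p = (p.map (stepVal y)).sum := rfl

theorem upathCost_append (y : Fin m → ℝ) (p q : List (Fin m × Bool)) :
    upathCost y (p ++ q) = upathCost y p + upathCost y q := by
  simp [upathCost_eq]

theorem uflowCarrying_iff {x : Fin m → ℝ} {p : List (Fin m × Bool)} :
    UFlowCarrying x p ↔ ∀ st ∈ p, 0 < stepVal x st := by
  refine forall₂_congr fun st _ => ?_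
  unfold stepVal
  split_ifs <;> simp

theorem UFlowCarrying.append {x : Fin m → ℝ} {p q : List (Fin m × Bool)}
    (hp : UFlowCarrying x p) (hq : UFlowCarrying x q) : UFlowCarrying x (p ++ q) := by
  intro st hst
  exact (List.mem_append.1 hst).elim (hp st) (hq st)

theorem upathCost_eq_zero {y : Fin m → ℝ} {p : List (Fin m × Bool)}
    (h : ∀ st ∈ p, y st.1 = 0) : upathCost y p = 0 := by
  rw [upathCost_eq]
  refine List.sum_eq_zero ?_
  intro c hc
  obtain ⟨st, hst, rfl⟩ := List.mem_map.1 hc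
  simp [stepVal, h st hst]

theorem upathCost_le_of_sublist {y : Fin m → ℝ} {p q : List (Fin m × Bool)}
    (hpq : p.Sublist q) (hq : ∀ st ∈ q, 0 ≤ stepVal y st) :
    upathCost y p ≤ upathCost y q := by
  refine (hpq.map _).sum_le_sum ?_
  intro c hc
  obtain ⟨st, hst, rfl⟩ := List.mem_map.1 hc
  exact hq st hst

theorem upathCost_eq_of_potential {y : Fin m → ℝ} {π : Fin n → ℝ}
    (hπ : ∀ e, π (tgt e) - π (src e) = y e) {a b : Fin n} {p : List (Fin m × Bool)}
    (hp : UWalk src tgt a b p) : upathCost y p = π b - π a := by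
  induction hp with
  | nil v => simp [upathCost]
  | consF e _ ih =>
    have := hπ e
    simp only [upathCost, List.map_cons, List.sum_cons, if_true] at ih ⊢
    linarith
  | consB e _ ih =>
    have := hπ e
    simp only [upathCost, List.map_cons, List.sum_cons, Bool.false_eq_true, if_false] at ih ⊢
    linarith

theorem stepVal_pos_of_sign {x y : Fin m → ℝ} (hpos : ∀ e, 0 < x e → 0 < y e)
    (hneg : ∀ e, x e < 0 → y e < 0) {st : Fin m × Bool} (h : 0 < stepVal x st) :
    0 < stepVal y st := by
  unfold stepVal at h ⊢
  split_ifs at h ⊢ with hd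
  · exact hpos _ h
  · have := hneg st.1 (by linarith)
    linarith

/-- Edge costs that come from a potential certify a Wardrop equilibrium. -/
theorem isUWardrop_of_potential {l : Fin m → ℝ → ℝ} {x : Fin m → ℝ} {s t : Fin n}
    (hpos : ∀ e ξ, 0 < ξ → 0 < l e ξ) (hneg : ∀ e ξ, ξ < 0 → l e ξ < 0) {π : Fin n → ℝ}
    (hπ : ∀ e, π (tgt e) - π (src e) = l e (x e)) : IsUWardrop src tgt s t l x := by
  refine ⟨?_, fun P Q hP hQ _ => ?_⟩
  · rintro ⟨v, p, hne, hw, hc⟩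
    have h0 := upathCost_eq_of_potential hπ hw
    have hlt : 0 < upathCost (fun e => l e (x e)) p := by
      rw [upathCost_eq]
      refine List.sum_pos _ ?_ (by simpa using hne)
      intro c hc'
      obtain ⟨st, hst, rfl⟩ := List.mem_map.1 hc'
      exact stepVal_pos_of_sign (fun e => hpos e _) (fun e => hneg e _)
        (uflowCarrying_iff.1 hc st hst)
    linarith
  · rw [upathCost_eq_of_potential hπ hP.1, upathCost_eq_of_potential hπ hQ.1]

end Costs

section Potentials

variable {n m : ℕ} {src tgt : Fin m → Fin n} {Γ : Matrix (Fin n) (Fin m) ℝ}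

theorem sum_mul_incidence (hsl : ∀ e, src e ≠ tgt e)
    (hΓ : ∀ v e, Γ v e = if v = tgt e then 1 else if v = src e then -1 else 0)
    (π : Fin n → ℝ) (e : Fin m) : ∑ v, π v * Γ v e = π (tgt e) - π (src e) := by
  have h : ∀ v, π v * Γ v e =
      (if v = tgt e then π v else 0) - (if v = src e then π v else 0) := by
    intro v
    rw [hΓ]
    by_cases h1 : v = tgt e
    · have h2 : v ≠ src e := fun h => hsl e (h.symm.trans h1)
      simp [h1, (hsl e).symm]
    · by_cases h2 : v = src e <;> simp [h1, h2]
      simp [hsl e]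
  simp [h, Finset.sum_sub_distrib]

theorem sum_potential_mul_excess (hsl : ∀ e, src e ≠ tgt e)
    (hΓ : ∀ v e, Γ v e = if v = tgt e then 1 else if v = src e then -1 else 0)
    (π : Fin n → ℝ) (x : Fin m → ℝ) :
    ∑ v, π v * ∑ e, Γ v e * x e = ∑ e, (π (tgt e) - π (src e)) * x e := by
  simp_rw [← sum_mul_incidence hsl hΓ π, Finset.mul_sum, Finset.sum_mul]
  rw [Finset.sum_comm]
  simp_rw [mul_assoc]

/-- A vector of edge values that annihilates all circulations comes from a potential. -/
theorem exists_potential_of_orthogonal (hsl : ∀ e, src e ≠ tgt e)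
    (hΓ : ∀ v e, Γ v e = if v = tgt e then 1 else if v = src e then -1 else 0)
    {g : Fin m → ℝ}
    (hg : ∀ c : Fin m → ℝ, (∀ v, ∑ e, Γ v e * c e = 0) → ∑ e, g e * c e = 0) :
    ∃ π : Fin n → ℝ, ∀ e, π (tgt e) - π (src e) = g e := by
  classical
  let L : Fin n → (Fin m → ℝ) →ₗ[ℝ] ℝ := fun v => Fintype.linearCombination ℝ (Γ v)
  let K : (Fin m → ℝ) →ₗ[ℝ] ℝ := Fintype.linearCombination ℝ g
  have hker : ⨅ v, LinearMap.ker (L v) ≤ LinearMap.ker K := by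
    intro c hc
    simp only [Submodule.mem_iInf, LinearMap.mem_ker] at hc ⊢
    have := hg c fun v => by
      rw [← hc v]
      simp [L, Fintype.linearCombination_apply, mul_comm]
    rw [← this]
    simp [K, Fintype.linearCombination_apply, mul_comm]
  have hmem := mem_span_of_iInf_ker_le_ker hker
  obtain ⟨π, hπ⟩ := (Submodule.mem_span_range_iff_exists_fun ℝ).1 hmem
  refine ⟨π, fun e => ?_⟩
  have h := LinearMap.congr_fun hπ (Pi.single e 1)
  rw [← sum_mul_incidence hsl hΓ π]
  simpa [L, K, LinearMap.sum_apply] using h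

variable {s t : Fin n} {q : ℝ} {x : Fin m → ℝ}

/-- If flow enters but never leaves a vertex set, then the set contains the sink and misses
the source. -/
theorem sink_mem_of_flow_entering (hsl : ∀ e, src e ≠ tgt e)
    (hΓ : ∀ v e, Γ v e = if v = tgt e then 1 else if v = src e then -1 else 0)
    (hq : 0 ≤ q)
    (hfeas : ∀ v, (∑ e, Γ v e * x e) = (if v = t then q else 0) - (if v = s then q else 0))
    {S : Set (Fin n)}
    (hS : ∀ st, 0 < stepVal x st → stepHead tgt src st ∈ S → stepHead src tgt st ∈ S)
    {st : Fin m × Bool} (hst : 0 < stepVal x st) (htail : stepHead tgt src st ∉ S)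
    (hhead : stepHead src tgt st ∈ S) : t ∈ S ∧ s ∉ S := by
  classical
  set ι : Fin n → ℝ := fun v => if v ∈ S then 1 else 0 with hι
  have hsum : (ι t - ι s) * q = ∑ e, (ι (tgt e) - ι (src e)) * x e := by
    rw [← sum_potential_mul_excess hsl hΓ]
    simp_rw [hfeas, mul_sub, mul_ite, mul_zero, Finset.sum_sub_distrib]
    simp [sub_mul]
  have hnonneg : ∀ e, 0 ≤ (ι (tgt e) - ι (src e)) * x e := by
    intro e
    have h₁ := hS (e, true)
    have h₂ := hS (e, false)
    simp only [stepVal, stepHead, if_true, Bool.false_eq_true, if_false] at h₁ h₂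
    by_cases hs : src e ∈ S <;> by_cases ht : tgt e ∈ S <;> simp only [hι, hs, ht, if_true,
      if_false, sub_self, zero_mul, le_refl]
    · by_contra! hc
      exact ht (h₁ (by linarith) hs)
    · by_contra! hc
      exact hs (h₂ (by linarith) ht)
  have hlt : 0 < ∑ e, (ι (tgt e) - ι (src e)) * x e := by
    refine Finset.sum_pos' (fun e _ => hnonneg e) ⟨st.1, Finset.mem_univ _, ?_⟩
    obtain ⟨e, d⟩ := st
    cases d <;> simp_all [stepVal, stepHead]
  rw [← hsum] at hlt
  by_cases ht : t ∈ S <;> by_cases hs : s ∈ S <;> simp [hι, ht, hs] at hlt ⊢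
  linarith

/-- In an acyclic flow every flow-carrying step lies on a flow-carrying walk from the source to
the sink. -/
theorem exists_flowCarrying_walks (hsl : ∀ e, src e ≠ tgt e)
    (hΓ : ∀ v e, Γ v e = if v = tgt e then 1 else if v = src e then -1 else 0)
    (hq : 0 ≤ q)
    (hfeas : ∀ v, (∑ e, Γ v e * x e) = (if v = t then q else 0) - (if v = s then q else 0))
    (hacyc : ¬ ∃ (v : Fin n) (p : List (Fin m × Bool)),
      p ≠ [] ∧ UWalk src tgt v v p ∧ UFlowCarrying x p)
    {st : Fin m × Bool} (hst : 0 < stepVal x st) :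
    (∃ P, UWalk src tgt s (stepHead tgt src st) P ∧ UFlowCarrying x P) ∧
    ∃ P, UWalk src tgt (stepHead src tgt st) t P ∧ UFlowCarrying x P := by
  have hone : ∀ st, 0 < stepVal x st →
      UWalk src tgt (stepHead tgt src st) (stepHead src tgt st) [st] ∧ UFlowCarrying x [st] :=
    fun st hst => ⟨uwalk_cons_iff.2 ⟨rfl, UWalk.nil _⟩, uflowCarrying_iff.2 (by simpa using hst)⟩
  constructor
  · have h := sink_mem_of_flow_entering hsl hΓ hq hfeas
      (S := {v | ¬ ∃ P, UWalk src tgt v (stepHead tgt src st) P ∧ UFlowCarrying x P})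
      ?_ hst ?_ ?_
    · simpa using h.2
    · rintro st' hst' hv ⟨P, hP, hc⟩
      exact hv ⟨[st'] ++ P, (hone st' hst').1.append hP, (hone st' hst').2.append hc⟩
    · simp only [Set.mem_ofPred_eq, not_not]
      exact ⟨[], UWalk.nil _, by simp [UFlowCarrying]⟩
    · rintro ⟨P, hP, hc⟩
      exact hacyc ⟨_, [st] ++ P, by simp, (hone st hst).1.append hP, (hone st hst).2.append hc⟩
  · have h := sink_mem_of_flow_entering hsl hΓ hq hfeas
      (S := {v | ∃ P, UWalk src tgt (stepHead src tgt st) v P ∧ UFlowCarrying x P})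
      ?_ hst ?_ ?_
    · exact h.1
    · rintro st' hst' ⟨P, hP, hc⟩
      exact ⟨P ++ [st'], hP.append (hone st' hst').1, hc.append (hone st' hst').2⟩
    · rintro ⟨P, hP, hc⟩
      exact hacyc ⟨_, [st] ++ P, by simp, (hone st hst).1.append hP, (hone st hst).2.append hc⟩
    · exact ⟨[], UWalk.nil _, by simp [UFlowCarrying]⟩

/-- The vertex `u` is joined by edges without flow to a vertex on a flow-carrying `s`-`t` walk
whose initial part up to that vertex has cost `c`. -/
def FlowDist (src tgt : Fin m → Fin n) (s t : Fin n) (x y : Fin m → ℝ) (u : Fin n) (c : ℝ) :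
    Prop :=
  ∃ v P R P', UWalk src tgt s v P ∧ UFlowCarrying x P ∧ UWalk src tgt v u R ∧
    (∀ st ∈ R, x st.1 = 0) ∧ UWalk src tgt v t P' ∧ UFlowCarrying x P' ∧ upathCost y P = c

theorem FlowDist.step {y : Fin m → ℝ} {u w : Fin n} {c : ℝ}
    (h : FlowDist src tgt s t x y u c) {st : Fin m × Bool} (hst : x st.1 = 0)
    (hu : stepHead tgt src st = u) (hw : stepHead src tgt st = w) :
    FlowDist src tgt s t x y w c := by
  obtain ⟨v, P, R, P', hP, hPc, hR, hR0, hP', hPc', hc⟩ := h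
  subst hu hw
  refine ⟨v, P, R ++ [st], P', hP, hPc, hR.append (uwalk_cons_iff.2 ⟨rfl, UWalk.nil _⟩), ?_,
    hP', hPc', hc⟩
  intro st' hst'
  rcases List.mem_append.1 hst' with h | h
  · exact hR0 _ h
  · rw [List.mem_singleton.1 h, hst]

/-- Edge costs of a Wardrop equilibrium come from a potential. -/
theorem IsUWardrop.exists_potential {l : Fin m → ℝ → ℝ} (hsl : ∀ e, src e ≠ tgt e)
    (hΓ : ∀ v e, Γ v e = if v = tgt e then 1 else if v = src e then -1 else 0)
    (hq : 0 ≤ q)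
    (hfeas : ∀ v, (∑ e, Γ v e * x e) = (if v = t then q else 0) - (if v = s then q else 0))
    (hpos : ∀ e ξ, 0 < ξ → 0 < l e ξ) (hneg : ∀ e ξ, ξ < 0 → l e ξ < 0)
    (hzero : ∀ e, l e 0 = 0) (hW : IsUWardrop src tgt s t l x) :
    ∃ π : Fin n → ℝ, ∀ e, π (tgt e) - π (src e) = l e (x e) := by
  obtain ⟨hacyc, hpath⟩ := hW
  set y : Fin m → ℝ := fun e => l e (x e) with hy
  have hy0 : ∀ e, x e = 0 → y e = 0 := fun e he => by simp [hy, he, hzero]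
  have hypos : ∀ st, 0 < stepVal x st → 0 < stepVal y st := fun st =>
    stepVal_pos_of_sign (fun e => hpos e _) (fun e => hneg e _)
  have hle : ∀ u c c', FlowDist src tgt s t x y u c → FlowDist src tgt s t x y u c' → c ≤ c' := by
    rintro u _ _ ⟨v, P, R, P₂, hP, hPc, hR, hR0, hP₂, hPc₂, rfl⟩
      ⟨v', P', R', -, hP', hPc', hR', hR0', -, -, rfl⟩
    obtain ⟨R'', hR'', hmem⟩ := hR.exists_reverse
    have hR0'' : ∀ st ∈ R'', x st.1 = 0 := by
      intro st hst
      obtain ⟨st', h₁, h₂⟩ := hmem st hst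
      rw [← h₂, hR0 st' h₁]
    obtain ⟨Q, hQ, hsub⟩ :=
      (hP'.append (hR'.append (hR''.append hP₂))).exists_simple_sublist
    have hcar := hPc.append hPc₂
    have hsimple : IsSimpleUPath src tgt s t (P ++ P₂) := by
      refine ⟨hP.append hP₂, ?_⟩
      by_contra hnd
      obtain ⟨p₁, c, p₂, w, heq, hc, -, hw, -⟩ :=
        (hP.append hP₂).exists_closed_of_not_nodup hnd
      exact hacyc ⟨w, c, hc, hw, fun st hst => hcar st (by rw [heq]; simp [hst])⟩
    have h₁ := hpath _ _ hsimple hQ hcar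
    have h₂ : upathCost y Q ≤ upathCost y (P' ++ (R' ++ (R'' ++ P₂))) := by
      refine upathCost_le_of_sublist hsub ?_
      have h0 : ∀ st : Fin m × Bool, x st.1 = 0 → 0 ≤ stepVal y st := fun st h => by
        simp [stepVal, hy0 _ h]
      intro st hst
      simp only [List.mem_append] at hst
      rcases hst with h | h | h | h
      · exact (hypos st (uflowCarrying_iff.1 hPc' st h)).le
      · exact h0 st (hR0' st h)
      · exact h0 st (hR0'' st h)
      · exact (hypos st (uflowCarrying_iff.1 hPc₂ st h)).le
    simp only [upathCost_append, upathCost_eq_zero fun st h => hy0 _ (hR0' st h),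
      upathCost_eq_zero fun st h => hy0 _ (hR0'' st h)] at h₁ h₂
    linarith
  let π : Fin n → ℝ := fun u => Classical.epsilon (FlowDist src tgt s t x y u)
  have hπ : ∀ u c, FlowDist src tgt s t x y u c → π u = c := fun u c h =>
    le_antisymm (hle _ _ _ (Classical.epsilon_spec ⟨c, h⟩) h)
      (hle _ _ _ h (Classical.epsilon_spec ⟨c, h⟩))
  have hflow : ∀ st, 0 < stepVal x st →
      π (stepHead src tgt st) - π (stepHead tgt src st) = stepVal y st := by
    intro st hst
    obtain ⟨⟨P, hP, hPc⟩, P', hP', hPc'⟩ :=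
      exists_flowCarrying_walks hsl hΓ hq hfeas hacyc hst
    have hw : UWalk src tgt (stepHead tgt src st) (stepHead src tgt st) [st] :=
      uwalk_cons_iff.2 ⟨rfl, UWalk.nil _⟩
    have hc : UFlowCarrying x [st] := uflowCarrying_iff.2 (by simpa using hst)
    rw [hπ _ _ ⟨_, P, [], [st] ++ P', hP, hPc, UWalk.nil _, by simp, hw.append hP',
        hc.append hPc', rfl⟩,
      hπ _ _ ⟨_, P ++ [st], [], P', hP.append hw, hPc.append hc, UWalk.nil _, by simp, hP',
        hPc', rfl⟩, upathCost_append]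
    simp [upathCost_eq]
  refine ⟨π, fun e => ?_⟩
  rcases lt_trichotomy (x e) 0 with he | he | he
  · have := hflow (e, false) (by simpa [stepVal] using he)
    simp only [stepVal, stepHead, Bool.false_eq_true, if_false] at this
    change _ = y e
    linarith
  · have : FlowDist src tgt s t x y (tgt e) = FlowDist src tgt s t x y (src e) := by
      funext c
      exact propext ⟨fun h => h.step (st := (e, false)) he rfl rfl,
        fun h => h.step (st := (e, true)) he rfl rfl⟩
    have hπe : π (tgt e) = π (src e) := by simp only [π, this]
    change _ = y e
    rw [hπe, sub_self, hy0 e he]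
  · have := hflow (e, true) (by simpa [stepVal] using he)
    simpa only [stepVal, stepHead, if_true] using this

end Potentials

section QuadraticProgram

/-- Quadratic upper bound for `u ↦ ½ (a (u⁺)² + b (u⁻)²)`, whose derivative is `a u⁺ + b u⁻`. -/
theorem piecewise_quadratic_le {a b : ℝ} (ha : 0 ≤ a) (hb : 0 ≤ b) (u h : ℝ) :
    (a * max (u + h) 0 * max (u + h) 0 + b * min (u + h) 0 * min (u + h) 0) / 2 ≤
      (a * max u 0 * max u 0 + b * min u 0 * min u 0) / 2 +
        (a * max u 0 + b * min u 0) * h + (a + b) * (h * h) / 2 := by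
  have h₁ : max (u + h) 0 * max (u + h) 0 ≤
      max u 0 * max u 0 + 2 * max u 0 * h + h * h := by
    rcases le_total u 0 with hu | hu <;> rcases le_total (u + h) 0 with hv | hv <;>
      simp only [hu, hv, max_eq_left, max_eq_right] <;> nlinarith
  have h₂ : min (u + h) 0 * min (u + h) 0 ≤
      min u 0 * min u 0 + 2 * min u 0 * h + h * h := by
    rcases le_total u 0 with hu | hu <;> rcases le_total (u + h) 0 with hv | hv <;>
      simp only [hu, hv, min_eq_left, min_eq_right] <;> nlinarith
  have h₃ := mul_le_mul_of_nonneg_left h₁ ha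
  have h₄ := mul_le_mul_of_nonneg_left h₂ hb
  linarith

theorem eq_zero_of_forall_quadratic_nonneg {G B : ℝ} (h : ∀ r : ℝ, 0 ≤ r * G + r * r * B) :
    G = 0 := by
  have hB : 0 < |B| + 1 := by positivity
  have h₁ := h (-G / (|B| + 1))
  have h₂ : B ≤ |B| := le_abs_self B
  by_contra hG
  have hG2 : 0 < G * G := mul_self_pos.2 hG
  have : -G / (|B| + 1) * G + -G / (|B| + 1) * (-G / (|B| + 1)) * B =
      G * G * (B - (|B| + 1)) / ((|B| + 1) * (|B| + 1)) := by
    field_simp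
    ring
  rw [this] at h₁
  have : G * G * (B - (|B| + 1)) / ((|B| + 1) * (|B| + 1)) < 0 :=
    div_neg_of_neg_of_pos (mul_neg_of_pos_of_neg hG2 (by linarith)) (by positivity)
  linarith

variable {n m : ℕ} {Γ : Matrix (Fin n) (Fin m) ℝ}

/-- First-order optimality condition of the piecewise quadratic program: the marginal costs of an
optimal solution annihilate all circulations. -/
theorem marginal_orthogonal_of_optimal {Δ : Fin n → ℝ} {a b : Fin m → ℝ}
    (ha : ∀ e, 0 ≤ a e) (hb : ∀ e, 0 ≤ b e) {x xp xm : Fin m → ℝ}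
    (hfeas : ∀ v, (∑ e, Γ v e * x e) = Δ v)
    (hx : ∀ e, x e = xp e + xm e) (hxp : ∀ e, 0 ≤ xp e) (hxm : ∀ e, xm e ≤ 0)
    (hopt : ∀ u up um : Fin m → ℝ,
      ((∀ v, (∑ e, Γ v e * u e) = Δ v) ∧
       (∀ e, u e = up e + um e) ∧ (∀ e, 0 ≤ up e) ∧ (∀ e, um e ≤ 0)) →
      (∑ e, a e * xp e * xp e) / 2 + (∑ e, b e * xm e * xm e) / 2 ≤
      (∑ e, a e * up e * up e) / 2 + (∑ e, b e * um e * um e) / 2)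
    {c : Fin m → ℝ} (hc : ∀ v, ∑ e, Γ v e * c e = 0) :
    ∑ e, (a e * max (x e) 0 + b e * min (x e) 0) * c e = 0 := by
  refine eq_zero_of_forall_quadratic_nonneg (B := (∑ e, (a e + b e) * (c e * c e)) / 2) ?_
  intro r
  have h₁ := hopt (fun e => x e + r * c e) (fun e => max (x e + r * c e) 0)
    (fun e => min (x e + r * c e) 0) ⟨fun v => by
      have : ∑ e, Γ v e * (x e + r * c e) = (∑ e, Γ v e * x e) + r * ∑ e, Γ v e * c e := by
        rw [Finset.mul_sum, ← Finset.sum_add_distrib]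
        exact Finset.sum_congr rfl fun e _ => by ring
      rw [this, hc, hfeas, mul_zero, add_zero],
      fun e => by simp [max_add_min], fun e => le_max_right _ _, fun e => min_le_right _ _⟩
  rw [← add_div, ← add_div, ← Finset.sum_add_distrib, ← Finset.sum_add_distrib] at h₁
  have h₂ : (∑ e, (a e * max (x e) 0 * max (x e) 0 + b e * min (x e) 0 * min (x e) 0)) ≤
      ∑ e, (a e * xp e * xp e + b e * xm e * xm e) := by
    refine Finset.sum_le_sum fun e _ => ?_
    have hp : max (x e) 0 ≤ xp e := max_le (by linarith [hx e, hxm e]) (hxp e)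
    have hm : -min (x e) 0 ≤ -xm e :=
      neg_le_neg (le_min (by linarith [hx e, hxp e]) (hxm e))
    have hp2 := mul_self_le_mul_self (le_max_right _ _) hp
    have hm2 := mul_self_le_mul_self (neg_nonneg.2 (min_le_right _ _)) hm
    have := mul_le_mul_of_nonneg_left hp2 (ha e)
    have := mul_le_mul_of_nonneg_left hm2 (hb e)
    linarith
  have h₃ := Finset.sum_le_sum fun e (_ : e ∈ Finset.univ) =>
    piecewise_quadratic_le (ha e) (hb e) (x e) (r * c e)
  rw [Finset.sum_add_distrib, Finset.sum_add_distrib, ← Finset.sum_div, ← Finset.sum_div] at h₃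
  have h₄ : ∑ e, (a e * max (x e) 0 + b e * min (x e) 0) * (r * c e) =
      r * ∑ e, (a e * max (x e) 0 + b e * min (x e) 0) * c e := by
    rw [Finset.mul_sum]
    exact Finset.sum_congr rfl fun e _ => by ring
  have h₅ : ∑ e, (a e + b e) * ((r * c e) * (r * c e)) / 2 =
      r * r * ((∑ e, (a e + b e) * (c e * c e)) / 2) := by
    rw [← Finset.sum_div, ← mul_div_assoc, Finset.mul_sum]
    congr 1
    exact Finset.sum_congr rfl fun e _ => by ring
  rw [h₄, h₅] at h₃
  linarith

end QuadraticProgram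

/-- Augmenting equilibria for undirected single-commodity networks: if
`x^q̃` is a Wardrop equilibrium for demand `q̃`, the (piecewise linear) costs have one-sided
slopes `a⁺`, `a⁻` at `x^q̃`, and `(x̂, x̂⁺, x̂⁻)` is an optimal solution of the associated
convex quadratic program, then there is `ε > 0` such that `x^q̃ + (q − q̃) x̂` is a Wardrop
equilibrium for demand `q` for every `q̃ ≤ q ≤ q̃ + ε`. -/
theorem augmenting_equilibrium_single_commodity
    (n m : ℕ) (src tgt : Fin m → Fin n)
    (hsl : ∀ e, src e ≠ tgt e)
    (hpar : ∀ e e', src e = src e' → tgt e = tgt e' → e = e')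
    (Γ : Matrix (Fin n) (Fin m) ℝ)
    (hΓ : ∀ v e, Γ v e = if v = tgt e then 1 else if v = src e then -1 else 0)
    (l : Fin m → ℝ → ℝ)
    (hcont : ∀ e, Continuous (l e))
    (hmono : ∀ e, StrictMono (l e))
    (hpos : ∀ e ξ, 0 < ξ → 0 < l e ξ)
    (hneg : ∀ e ξ, ξ < 0 → l e ξ < 0)
    (s t : Fin n) (qt : ℝ) (hqt : 0 ≤ qt)
    (xq : Fin m → ℝ)
    (hfeas : ∀ v, (∑ e, Γ v e * xq e) = (if v = t then qt else 0) - (if v = s then qt else 0))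
    (hW : IsUWardrop src tgt s t l xq)
    (aplus aminus : Fin m → ℝ)
    -- the cost of `e` is piecewise linear at `x_e^q̃` with right slope `a⁺_e`, left slope `a⁻_e`
    (hslope : ∀ e, ∃ δ > (0 : ℝ),
      (∀ ξ, xq e ≤ ξ → ξ ≤ xq e + δ → l e ξ = l e (xq e) + aplus e * (ξ - xq e)) ∧
      (∀ ξ, xq e - δ ≤ ξ → ξ ≤ xq e → l e ξ = l e (xq e) + aminus e * (ξ - xq e)))
    (xhat xhatp xhatm : Fin m → ℝ)
    -- `(x̂, x̂⁺, x̂⁻)` is feasible for the convex program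
    (hfeasProg :
      (∀ v, (∑ e, Γ v e * xhat e) = (if v = t then (1 : ℝ) else 0) - (if v = s then 1 else 0)) ∧
      (∀ e, xhat e = xhatp e + xhatm e) ∧ (∀ e, 0 ≤ xhatp e) ∧ (∀ e, xhatm e ≤ 0))
    -- `(x̂, x̂⁺, x̂⁻)` minimizes `½ (x⁺)ᵀ A⁺ x⁺ + ½ (x⁻)ᵀ A⁻ x⁻` among all feasible points
    (hopt : ∀ u up um : Fin m → ℝ,
      ((∀ v, (∑ e, Γ v e * u e) = (if v = t then (1 : ℝ) else 0) - (if v = s then 1 else 0)) ∧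
       (∀ e, u e = up e + um e) ∧ (∀ e, 0 ≤ up e) ∧ (∀ e, um e ≤ 0)) →
      (∑ e, aplus e * xhatp e * xhatp e) / 2 + (∑ e, aminus e * xhatm e * xhatm e) / 2 ≤
      (∑ e, aplus e * up e * up e) / 2 + (∑ e, aminus e * um e * um e) / 2) :
    ∃ ε > (0 : ℝ), ∀ q : ℝ, qt ≤ q → q ≤ qt + ε →
      (∀ v, (∑ e, Γ v e * (xq e + (q - qt) * xhat e)) =
        (if v = t then q else 0) - (if v = s then q else 0)) ∧
      IsUWardrop src tgt s t l (fun e => xq e + (q - qt) * xhat e) := by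
  obtain ⟨hfeasHat, hsplit, hxp, hxm⟩ := hfeasProg
  choose δ hδ hright hleft using hslope
  have hap : ∀ e, 0 ≤ aplus e := by
    intro e
    have h₁ := hright e (xq e + δ e) (by linarith [hδ e]) le_rfl
    have h₂ := hmono e (show xq e < xq e + δ e by linarith [hδ e])
    have h₃ : 0 < aplus e * δ e := by linarith
    exact (pos_of_mul_pos_left h₃ (hδ e).le).le
  have ham : ∀ e, 0 ≤ aminus e := by
    intro e
    have h₁ := hleft e (xq e - δ e) le_rfl (by linarith [hδ e])
    have h₂ := hmono e (show xq e - δ e < xq e by linarith [hδ e])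
    have h₃ : 0 < aminus e * δ e := by linarith
    exact (pos_of_mul_pos_left h₃ (hδ e).le).le
  have hzero : ∀ e, l e 0 = 0 := by
    intro e
    refine le_antisymm ?_ ?_
    · refine le_of_tendsto ((hcont e).tendsto 0 |>.mono_left (nhdsWithin_le_nhds (s := Set.Iio 0)))
        ?_
      filter_upwards [self_mem_nhdsWithin] with ξ hξ using (hneg e ξ hξ).le
    · refine ge_of_tendsto ((hcont e).tendsto 0 |>.mono_left (nhdsWithin_le_nhds (s := Set.Ioi 0)))
        ?_
      filter_upwards [self_mem_nhdsWithin] with ξ hξ using (hpos e ξ hξ).le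
  obtain ⟨π, hπ⟩ := hW.exists_potential hsl hΓ hqt hfeas hpos hneg hzero
  obtain ⟨ρ, hρ⟩ := exists_potential_of_orthogonal hsl hΓ fun c hc =>
    marginal_orthogonal_of_optimal hap ham hfeasHat hsplit hxp hxm hopt hc
  obtain ⟨ε, hε, hεδ⟩ : ∃ ε > (0 : ℝ), ∀ e, ε * |xhat e| ≤ δ e := by
    have hev : ∀ e, ∀ᶠ r in nhdsWithin (0 : ℝ) (Set.Ioi 0), r * |xhat e| ≤ δ e := by
      intro e
      have : Filter.Tendsto (fun r : ℝ => r * |xhat e|) (nhds 0) (nhds (0 * |xhat e|)) :=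
        (continuous_id.mul continuous_const).tendsto 0
      rw [zero_mul] at this
      exact ((this.eventually_lt_const (hδ e)).filter_mono nhdsWithin_le_nhds).mono
        fun r hr => hr.le
    obtain ⟨ε, h₁, h₂⟩ := ((Filter.eventually_all.2 hev).and self_mem_nhdsWithin).exists
    exact ⟨ε, h₂, h₁⟩
  refine ⟨ε, hε, fun q hq₁ hq₂ => ⟨fun v => ?_, ?_⟩⟩
  · have : ∑ e, Γ v e * (xq e + (q - qt) * xhat e) =
        (∑ e, Γ v e * xq e) + (q - qt) * ∑ e, Γ v e * xhat e := by
      rw [Finset.mul_sum, ← Finset.sum_add_distrib]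
      exact Finset.sum_congr rfl fun e _ => by ring
    rw [this, hfeas, hfeasHat]
    split_ifs <;> ring
  · refine isUWardrop_of_potential (π := fun v => π v + (q - qt) * ρ v) hpos hneg fun e => ?_
    have hr : 0 ≤ q - qt := by linarith
    have hstep : (q - qt) * |xhat e| ≤ δ e :=
      (mul_le_mul_of_nonneg_right (by linarith) (abs_nonneg _)).trans (hεδ e)
    have hsum : π (tgt e) + (q - qt) * ρ (tgt e) - (π (src e) + (q - qt) * ρ (src e)) =
        l e (xq e) + (q - qt) * (aplus e * max (xhat e) 0 + aminus e * min (xhat e) 0) := by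
      rw [← hπ e, ← hρ e]
      ring
    rw [hsum]
    rcases le_total 0 (xhat e) with hx | hx
    · rw [abs_of_nonneg hx] at hstep
      rw [hright e (xq e + (q - qt) * xhat e) (by linarith [mul_nonneg hr hx]) (by linarith),
        max_eq_left hx, min_eq_right hx]
      ring
    · rw [abs_of_nonpos hx] at hstep
      rw [hleft e (xq e + (q - qt) * xhat e) (by linarith)
          (by linarith [mul_nonpos_of_nonneg_of_nonpos hr hx]),
        max_eq_right hx, min_eq_left hx]
      ring
end

section
/- Let v₁, w₁, v₂, w₂ ∈ ℝⁿ and α₁, α₂ ∈ ℝ \ {0}. Let A ∈ ℝ^{n×n} be any matrix (possibly singular) such that A lies in the domains of both ⊠^{α₁}_{v₁,w₁} and ⊠^{α₂}_{v₂,w₂}, the matrix ⊠^{α₂}_{v₂,w₂}(A) lies in the domain of ⊠^{α₁}_{v₁,w₁}, and the matrix ⊠^{α₁}_{v₁,w₁}(A) lies in the domain of ⊠^{α₂}_{v₂,w₂}. Then the two operators commute on A: ⊠^{α₁}_{v₁,w₁}( ⊠^{α₂}_{v₂,w₂}(A) ) = ⊠^{α₂}_{v₂,w₂}( ⊠^{α₁}_{v₁,w₁}(A)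 ). -/
open Matrix

/-- The Sherman–Morrison operator
`⊠^α_{v,w}(A) = (I − (α/(1 + α vᵀ A w)) A w vᵀ) A`, defined for matrices `A` with
`vᵀ A w ≠ −1/α`. -/
noncomputable def smOp {n : ℕ} (v w : Fin n → ℝ) (α : ℝ)
    (A : Matrix (Fin n) (Fin n) ℝ) : Matrix (Fin n) (Fin n) ℝ :=
  ((1 : Matrix (Fin n) (Fin n) ℝ) -
      (α / (1 + α * (v ⬝ᵥ (A *ᵥ w)))) • (A * Matrix.vecMulVec w v)) * A

/-- The denominator of the Sherman–Morrison operator does not vanish on its domain. -/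
lemma one_add_mul_ne_zero_of_ne_neg_one_div {a x : ℝ} (ha : a ≠ 0) (h : x ≠ -1 / a) :
    1 + a * x ≠ 0 := by
  intro h0
  apply h
  rw [eq_div_iff ha]
  linarith

lemma smOp_eq_sub_vecMulVec {n : ℕ} (v w : Fin n → ℝ) (α : ℝ) (A : Matrix (Fin n) (Fin n) ℝ) :
    smOp v w α A =
      A - (α / (1 + α * (v ⬝ᵥ (A *ᵥ w)))) • vecMulVec (A *ᵥ w) (v ᵥ* A) := by
  rw [smOp, sub_mul, one_mul, smul_mul_assoc, mul_vecMulVec, vecMulVec_mul]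

lemma smOp_mulVec {n : ℕ} (v w x : Fin n → ℝ) (α : ℝ) (A : Matrix (Fin n) (Fin n) ℝ) :
    smOp v w α A *ᵥ x =
      A *ᵥ x - (α / (1 + α * (v ⬝ᵥ (A *ᵥ w))) * (v ⬝ᵥ (A *ᵥ x))) • (A *ᵥ w) := by
  rw [smOp_eq_sub_vecMulVec, sub_mulVec, smul_mulVec, vecMulVec_mulVec, dotProduct_mulVec v A x,
    op_smul_eq_smul, smul_smul]

lemma vecMul_smOp {n : ℕ} (v w x : Fin n → ℝ) (α : ℝ) (A : Matrix (Fin n) (Fin n) ℝ) :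
    x ᵥ* smOp v w α A =
      x ᵥ* A - (α / (1 + α * (v ⬝ᵥ (A *ᵥ w))) * (x ⬝ᵥ (A *ᵥ w))) • (v ᵥ* A) := by
  rw [smOp_eq_sub_vecMulVec, vecMul_sub, vecMul_smul, vecMul_vecMulVec, smul_smul]

lemma dotProduct_smOp_mulVec {n : ℕ} (v w x y : Fin n → ℝ) (α : ℝ)
    (A : Matrix (Fin n) (Fin n) ℝ) :
    x ⬝ᵥ (smOp v w α A *ᵥ y) =
      x ⬝ᵥ (A *ᵥ y) -
        α / (1 + α * (v ⬝ᵥ (A *ᵥ w))) * (v ⬝ᵥ (A *ᵥ y)) * (x ⬝ᵥ (A *ᵥ w)) := by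
  rw [smOp_mulVec, dotProduct_sub, dotProduct_smul, smul_eq_mul]

/-- Two Sherman–Morrison operators commute on every (possibly singular)
matrix `A` for which all four applications are within the respective domains:
`⊠^{α₁}_{v₁,w₁}(⊠^{α₂}_{v₂,w₂}(A)) = ⊠^{α₂}_{v₂,w₂}(⊠^{α₁}_{v₁,w₁}(A))`. -/
theorem smOp_comm
    (n : ℕ) (v₁ w₁ v₂ w₂ : Fin n → ℝ) (α₁ α₂ : ℝ)
    (hα₁ : α₁ ≠ 0) (hα₂ : α₂ ≠ 0)
    (A : Matrix (Fin n) (Fin n) ℝ)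
    (h₁ : v₁ ⬝ᵥ (A *ᵥ w₁) ≠ -1 / α₁)
    (h₂ : v₂ ⬝ᵥ (A *ᵥ w₂) ≠ -1 / α₂)
    (h₂₁ : v₁ ⬝ᵥ ((smOp v₂ w₂ α₂ A) *ᵥ w₁) ≠ -1 / α₁)
    (h₁₂ : v₂ ⬝ᵥ ((smOp v₁ w₁ α₁ A) *ᵥ w₂) ≠ -1 / α₂) :
    smOp v₁ w₁ α₁ (smOp v₂ w₂ α₂ A) = smOp v₂ w₂ α₂ (smOp v₁ w₁ α₁ A) := by
  have d₁ := one_add_mul_ne_zero_of_ne_neg_one_div hα₁ h₁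
  have d₂ := one_add_mul_ne_zero_of_ne_neg_one_div hα₂ h₂
  have d₂₁ := one_add_mul_ne_zero_of_ne_neg_one_div hα₁ h₂₁
  have d₁₂ := one_add_mul_ne_zero_of_ne_neg_one_div hα₂ h₁₂
  rw [smOp_eq_sub_vecMulVec v₁ w₁ α₁ (smOp v₂ w₂ α₂ A),
    smOp_eq_sub_vecMulVec v₂ w₂ α₂ (smOp v₁ w₁ α₁ A)]
  rw [dotProduct_smOp_mulVec] at d₂₁ d₁₂ ⊢
  rw [dotProduct_smOp_mulVec, smOp_mulVec, smOp_mulVec, vecMul_smOp, vecMul_smOp,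
    smOp_eq_sub_vecMulVec, smOp_eq_sub_vecMulVec]
  ext i j
  simp only [Matrix.sub_apply, Matrix.smul_apply, vecMulVec_apply, Pi.sub_apply, Pi.smul_apply, smul_eq_mul]
  generalize v₁ ⬝ᵥ (A *ᵥ w₁) = p at *
  generalize v₂ ⬝ᵥ (A *ᵥ w₂) = q at *
  generalize v₁ ⬝ᵥ (A *ᵥ w₂) = r at *
  generalize v₂ ⬝ᵥ (A *ᵥ w₁) = s at *
  generalize (A *ᵥ w₁) i = x₁
  generalize (A *ᵥ w₂) i = x₂
  generalize (v₁ ᵥ* A) j = y₁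
  generalize (v₂ ᵥ* A) j = y₂
  -- Both iterated denominators are multiples of the same `2 × 2` determinant.
  have e₂₁ : 1 + α₁ * (p - α₂ / (1 + α₂ * q) * s * r) =
      ((1 + α₁ * p) * (1 + α₂ * q) - α₁ * α₂ * r * s) / (1 + α₂ * q) := by
    field_simp
    ring
  have e₁₂ : 1 + α₂ * (q - α₁ / (1 + α₁ * p) * r * s) =
      ((1 + α₁ * p) * (1 + α₂ * q) - α₁ * α₂ * r * s) / (1 + α₁ * p) := by
    field_simp
    ring
  have d : (1 + α₁ * p) * (1 + α₂ * q) - α₁ * α₂ * r * s ≠ 0 := by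
    rw [e₂₁] at d₂₁
    exact fun h => d₂₁ (by rw [h, zero_div])
  rw [e₂₁, e₁₂]
  generalize hD : (1 + α₁ * p) * (1 + α₂ * q) - α₁ * α₂ * r * s = D at d ⊢
  field_simp
  rw [← hD]
  ring
end
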